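/- Let t = (t_1,t_2,t_3,t_4) be a sequence of nonnegative integers with t_3 ≥ 1, and write s_k = s_k(t) = t_1+⋯+t_k. Then Q(t_1,t_2,t_3,t_4)/Q(t_1,t_2,t_3-1,t_4) = (s_4/s_3) · (2s_4-1)! · (2s_3)! · (s_4-s_1-1)! (s_3-s_2-1)! (s_4+s_2)! (s_3+s_1)! / [ (s_4-s_2-1)! (s_3-s_1-1)! (s_4+s_1)! (s_3+s_2)! (s_4+s_3-1)! (s_4+s_3)! ]. -/

import Mathlib

open Finset Nat

/-- Pochhammer symbol `(q)_n` for real `q` and integer `n`. -/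
noncomputable def poch (q : ℝ) (n : ℤ) : ℝ :=
  if 0 ≤ n then ∏ i ∈ Finset.range n.toNat, (q + i)
  else 1 / ∏ i ∈ Finset.range (-n).toNat, (q - (i + 1))

/-- Skipping Pochhammer symbol `[q]_n`. -/
noncomputable def spoch (q : ℝ) (n : ℤ) : ℝ :=
  if 0 ≤ n then ∏ i ∈ Finset.range n.toNat, (q + 2 * i)
  else 1 / ∏ i ∈ Finset.range (-n).toNat, (q - 2 * (i + 1))

/-- Trapezoidal product `T(q,n,m) = ∏_{i=0}^{m-1} (q+i)_{n-2i}`. -/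
noncomputable def trapT (q : ℝ) (n m : ℤ) : ℝ :=
  ∏ i ∈ Finset.range m.toNat, poch (q + i) (n - 2 * i)

/-- Skipping trapezoidal product `V(q,n,m) = ∏_{i=0}^{m-1} [q+2i]_{n-2i}`. -/
noncomputable def trapV (q : ℝ) (n m : ℤ) : ℝ :=
  ∏ i ∈ Finset.range m.toNat, spoch (q + 2 * i) (n - 2 * i)

/-- Hyperfactorial `H(n) = 0!·1!·2!⋯(n-1)!`. -/
def hyperfac (n : ℕ) : ℕ := ∏ i ∈ Finset.range n, i !

/-- Skipping hyperfactorial `H₂(n)`: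
`0!·2!·4!⋯(n-2)!` if `n` is even, `1!·3!·5!⋯(n-2)!` if `n` is odd. -/
def hyperfac2 (n : ℕ) : ℕ :=
  ∏ i ∈ Finset.range (n / 2), (if n % 2 = 0 then (2 * i)! else (2 * i + 1)!)

/-- Partial sum `s_k(t) = t 1 + ⋯ + t k` (sequences are indexed from 1). -/
def pSum (t : ℕ → ℕ) (k : ℕ) : ℕ := ∑ i ∈ Finset.Icc 1 k, t i

/-- `E(t) = t 2 + t 4 + ⋯ + t (2l)` for a sequence of length `2l`. -/
def evenSum (l : ℕ) (t : ℕ → ℕ) : ℕ := ∑ i ∈ Finset.Icc 1 l, t (2 * i)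

/-- `Q(t₁,…,t_{2l})`. -/
noncomputable def Qfun (l : ℕ) (t : ℕ → ℕ) : ℝ :=
  ((∏ i ∈ Finset.Icc 1 l, ((pSum t (2 * i))! : ℝ) / ((pSum t (2 * i - 1))! : ℝ)) /
      (hyperfac2 (2 * evenSum l t + 1) : ℝ)) *
    (∏ i ∈ Finset.Icc 1 l,
      ((hyperfac2 (2 * pSum t (2 * i) + 1) : ℝ) * (hyperfac (2 * pSum t (2 * i - 1) + 2) : ℝ)) /
        (hyperfac2 (2 * pSum t (2 * i - 1) + 3) : ℝ)) *
    (∏ p ∈ (Finset.Icc 1 (2 * l) ×ˢ Finset.Icc 1 (2 * l)).filter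
        (fun p => p.1 < p.2 ∧ (p.2 - p.1) % 2 = 1),
      (hyperfac (pSum t p.2 - pSum t p.1) : ℝ) / (hyperfac (pSum t p.2 + pSum t p.1 + 1) : ℝ)) *
    (∏ p ∈ (Finset.Icc 1 (2 * l) ×ˢ Finset.Icc 1 (2 * l)).filter
        (fun p => p.1 < p.2 ∧ (p.2 - p.1) % 2 = 0),
      (hyperfac (pSum t p.2 + pSum t p.1 + 1) : ℝ) / (hyperfac (pSum t p.2 - pSum t p.1) : ℝ))

/-- Build an indexed-from-1 sequence from a list. -/
def seqOf (L : List ℕ) : ℕ → ℕ := fun i => L.getD (i - 1) 0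

/-- `Q` on four entries. -/
noncomputable def Q4 (t1 t2 t3 t4 : ℕ) : ℝ := Qfun 2 (seqOf [t1, t2, t3, t4])

/-- Proctor's product formula `P_{a,b,c}`. -/
noncomputable def Pf (a b c : ℕ) : ℝ :=
  ∏ i ∈ Finset.Icc 1 a,
    ((∏ j ∈ Finset.Icc 1 (b - a + 1), ((c + i + j - 1 : ℕ) : ℝ) / ((i + j - 1 : ℕ) : ℝ)) *
      ∏ j ∈ Finset.Icc (b - a + 2) (b - a + i),
        ((2 * c + i + j - 1 : ℕ) : ℝ) / ((i + j - 1 : ℕ) : ℝ))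

/-- Ciucu's product formula `P′_{a,b,c}`. -/
noncomputable def Pf' (a b c : ℕ) : ℝ :=
  (2 : ℝ) ^ (-(a : ℤ)) *
    (∏ i ∈ Finset.Icc 1 a, ((2 * c + (b - a) + i : ℕ) : ℝ) / ((c + (b - a) + i : ℕ) : ℝ)) *
    Pf a b c

/-- `φ_{x,y,z}(a,b)`. -/
noncomputable def phi (x y z a b : ℕ) : ℝ :=
  (Pf y (y + 2 * a) b * Pf (z + b) (z + b) a * Q4 a b x (y + z) /
      Pf (y + z + b) (y + z + b) a) *
    (trapT ((x : ℝ) + b + 1) ((y : ℤ) + a - 1) a *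
      trapT ((x : ℝ) + z + a + b + 2) ((y : ℤ) + a - 1) a *
      trapT (2 * (a : ℝ) + b + 2) ((y : ℤ) + b - 1) b *
      trapT ((z : ℝ) + 1) ((y : ℤ) + b - 1) b) /
    (trapT ((b : ℝ) + 1) ((y : ℤ) + a - 1) a *
      trapT ((z : ℝ) + a + b + 2) ((y : ℤ) + a - 1) a *
      trapT ((x : ℝ) + 2 * a + b + 2) ((y : ℤ) + b - 1) b *
      trapT ((x : ℝ) + z + 1) ((y : ℤ) + b - 1) b)

/-- `ψ_{x,y,z}(a,b)`. -/
noncomputable def psi (x y z a b : ℕ) : ℝ :=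
  (Pf' y (y + 2 * a + 1) b * Pf (z + b) (z + b) a * Q4 a b x (y + z) /
      Pf (y + z + b) (y + z + b) a) *
    (trapV (2 * (a : ℝ) + 2 * b + 3) ((y : ℤ) + z - 1) y /
      trapV (2 * (x : ℝ) + 2 * a + 2 * b + 3) ((y : ℤ) + z - 1) y) *
    (trapT ((x : ℝ) + b + 1) ((y : ℤ) + z + 2 * a) y *
      trapT (2 * (a : ℝ) + b + 2) ((y : ℤ) + b - 1) b *
      trapT ((z : ℝ) + 1) ((y : ℤ) + b - 1) b) /
    (trapT ((b : ℝ) + 1) ((y : ℤ) + z + 2 * a) y *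
      trapT ((x : ℝ) + 2 * a + b + 2) ((y : ℤ) + b - 1) b *
      trapT ((x : ℝ) + z + 1) ((y : ℤ) + b - 1) b)

lemma hyperfac_succ' (n : ℕ) : (hyperfac (n + 1) : ℝ) = hyperfac n * (n ! : ℝ) := by
  unfold hyperfac
  rw [Finset.prod_range_succ]
  push_cast
  ring

lemma hyperfac_ne (n : ℕ) : (hyperfac n : ℝ) ≠ 0 := by
  unfold hyperfac
  exact_mod_cast Finset.prod_ne_zero_iff.mpr fun i _ => Nat.factorial_ne_zero i

lemma hyperfac2_odd (n : ℕ) :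
    hyperfac2 (2 * n + 1) = ∏ i ∈ Finset.range n, (2 * i + 1)! := by
  unfold hyperfac2
  have h1 : (2 * n + 1) / 2 = n := by omega
  have h2 : (2 * n + 1) % 2 = 1 := by omega
  rw [h1, h2]
  simp

lemma hyperfac2_succ' (n : ℕ) :
    (hyperfac2 (2 * n + 3) : ℝ) = hyperfac2 (2 * n + 1) * ((2 * n + 1)! : ℝ) := by
  have h : 2 * n + 3 = 2 * (n + 1) + 1 := by ring
  rw [h, hyperfac2_odd, hyperfac2_odd, Finset.prod_range_succ]
  push_cast
  ring

lemma hyperfac2_ne (n : ℕ) : (hyperfac2 n : ℝ) ≠ 0 := by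
  unfold hyperfac2
  norm_cast
  refine Finset.prod_ne_zero_iff.mpr fun i _ => ?_
  split_ifs <;> exact Nat.factorial_ne_zero _

lemma fac_ne (n : ℕ) : (n ! : ℝ) ≠ 0 := by
  exact_mod_cast Nat.factorial_ne_zero n

/-- Explicit form of `Q4` in terms of partial sums. -/
lemma Q4_eq (a x n y : ℕ) :
    Q4 a x n y =
      (((a + x)! : ℝ) / (a ! : ℝ) * (((a + x + n + y)! : ℝ) / ((a + x + n)! : ℝ)) /
        (hyperfac2 (2 * (x + y) + 1) : ℝ)) *
      (((hyperfac2 (2 * (a + x) + 1) : ℝ) * (hyperfac (2 * a + 2) : ℝ)) /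
          (hyperfac2 (2 * a + 3) : ℝ) *
        (((hyperfac2 (2 * (a + x + n + y) + 1) : ℝ) * (hyperfac (2 * (a + x + n) + 2) : ℝ)) /
          (hyperfac2 (2 * (a + x + n) + 3) : ℝ))) *
      (((hyperfac x : ℝ) / (hyperfac (a + x + a + 1) : ℝ)) *
        ((hyperfac (x + n + y) : ℝ) / (hyperfac (a + x + n + y + a + 1) : ℝ)) *
        ((hyperfac n : ℝ) / (hyperfac (a + x + n + (a + x) + 1) : ℝ)) *
        ((hyperfac y : ℝ) / (hyperfac (a + x + n + y + (a + x + n) + 1) : ℝ))) *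
      (((hyperfac (a + x + n + a + 1) : ℝ) / (hyperfac (x + n) : ℝ)) *
        ((hyperfac (a + x + n + y + (a + x) + 1) : ℝ) / (hyperfac (n + y) : ℝ))) := by
  have p1 : pSum (seqOf [a, x, n, y]) 1 = a := by simp [pSum, seqOf]
  have p2 : pSum (seqOf [a, x, n, y]) 2 = a + x := by
    simp [pSum, seqOf, Finset.sum_Icc_succ_top]
  have p3 : pSum (seqOf [a, x, n, y]) 3 = a + x + n := by
    simp [pSum, seqOf, Finset.sum_Icc_succ_top]
  have p4 : pSum (seqOf [a, x, n, y]) 4 = a + x + n + y := by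
    simp [pSum, seqOf, Finset.sum_Icc_succ_top]
  have e : evenSum 2 (seqOf [a, x, n, y]) = x + y := by
    simp [evenSum, seqOf, Finset.sum_Icc_succ_top]
  have f1 : (Finset.Icc 1 (2 * 2) ×ˢ Finset.Icc 1 (2 * 2)).filter
      (fun p : ℕ × ℕ => p.1 < p.2 ∧ (p.2 - p.1) % 2 = 1) = {(1, 2), (1, 4), (2, 3), (3, 4)} := by
    decide
  have f2 : (Finset.Icc 1 (2 * 2) ×ˢ Finset.Icc 1 (2 * 2)).filter
      (fun p : ℕ × ℕ => p.1 < p.2 ∧ (p.2 - p.1) % 2 = 0) = {(1, 3), (2, 4)} := by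
    decide
  have f3 : Finset.Icc 1 2 = ({1, 2} : Finset ℕ) := by decide
  have d1 : a + x - a = x := by omega
  have d2 : a + x + n + y - a = x + n + y := by omega
  have d3 : a + x + n - (a + x) = n := by omega
  have d4 : a + x + n + y - (a + x + n) = y := by omega
  have d5 : a + x + n - a = x + n := by omega
  have d6 : a + x + n + y - (a + x) = n + y := by omega
  unfold Q4 Qfun
  rw [f1, f2, f3, e]
  rw [Finset.prod_pair (by decide), Finset.prod_pair (by decide), Finset.prod_pair (by decide),
    Finset.prod_insert (by decide), Finset.prod_insert (by decide), Finset.prod_pair (by decide)]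
  simp only [Nat.mul_one, Nat.reduceMul, Nat.reduceSub, p1, p2, p3, p4, d1, d2, d3, d4, d5, d6]
  ring

/-- ratio `Q(t₁,t₂,t₃,t₄)/Q(t₁,t₂,t₃-1,t₄)`. -/
theorem claim_Q4_ratio (t1 t2 t3 t4 : ℕ) (h3 : 1 ≤ t3) :
    Q4 t1 t2 t3 t4 / Q4 t1 t2 (t3 - 1) t4 =
      (((t1 + t2 + t3 + t4 : ℕ) : ℝ) / ((t1 + t2 + t3 : ℕ) : ℝ)) *
        ((2 * (t1 + t2 + t3 + t4) - 1)! : ℝ) * ((2 * (t1 + t2 + t3))! : ℝ) *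
        (((t1 + t2 + t3 + t4 - t1 - 1)! : ℝ) * ((t1 + t2 + t3 - (t1 + t2) - 1)! : ℝ) *
            ((t1 + t2 + t3 + t4 + (t1 + t2))! : ℝ) * ((t1 + t2 + t3 + t1)! : ℝ)) /
        (((t1 + t2 + t3 + t4 - (t1 + t2) - 1)! : ℝ) * ((t1 + t2 + t3 - t1 - 1)! : ℝ) *
            ((t1 + t2 + t3 + t4 + t1)! : ℝ) * ((t1 + t2 + t3 + (t1 + t2))! : ℝ) *
            ((t1 + t2 + t3 + t4 + (t1 + t2 + t3) - 1)! : ℝ) *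
            ((t1 + t2 + t3 + t4 + (t1 + t2 + t3))! : ℝ)) := by
  obtain ⟨n, rfl⟩ : ∃ n, t3 = n + 1 := ⟨t3 - 1, by omega⟩
  rw [Nat.add_sub_cancel, Q4_eq, Q4_eq]
  obtain ⟨c, hc⟩ : ∃ c, c = t1 + t2 + n := ⟨_, rfl⟩
  obtain ⟨d, hd⟩ : ∃ d, d = t1 + t2 + n + t4 := ⟨_, rfl⟩
  have e1 : t1 + t2 + (n + 1) + t4 = d + 1 := by omega
  have e2 : t1 + t2 + (n + 1) = c + 1 := by omega
  have e3 : t2 + (n + 1) + t4 = t2 + n + t4 + 1 := by omega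
  have e4 : t2 + (n + 1) = t2 + n + 1 := by omega
  have e5 : n + 1 + t4 = n + t4 + 1 := by omega
  have g1 : 2 * (d + 1) - 1 = 2 * d + 1 := by omega
  have g2 : d + 1 - t1 - 1 = t2 + n + t4 := by omega
  have g3 : c + 1 - (t1 + t2) - 1 = n := by omega
  have g4 : d + 1 - (t1 + t2) - 1 = n + t4 := by omega
  have g5 : c + 1 - t1 - 1 = t2 + n := by omega
  have g6 : d + 1 + (c + 1) - 1 = d + c + 1 := by omega
  have k1 : d + 1 + (c + 1) = d + c + 2 := by omega
  have k2 : d + 1 + t1 = d + t1 + 1 := by omega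
  have k3 : c + 1 + t1 = c + t1 + 1 := by omega
  have k4 : d + 1 + (t1 + t2) = d + (t1 + t2) + 1 := by omega
  have k5 : c + 1 + (t1 + t2) = c + (t1 + t2) + 1 := by omega
  rw [e1, e2, e3, e4, e5, g1, g2, g3, g4, g5, g6, k1, k2, k3, k4, k5, ← hd, ← hc]
  have r1 : (hyperfac2 (2 * (d + 1) + 1) : ℝ) = hyperfac2 (2 * d + 1) * ((2 * d + 1)! : ℝ) :=
    hyperfac2_succ' d
  have r2 : (hyperfac2 (2 * (c + 1) + 3) : ℝ) = hyperfac2 (2 * c + 3) * ((2 * c + 3)! : ℝ) :=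
    hyperfac2_succ' (c + 1)
  have r3 : (hyperfac (2 * (c + 1) + 2) : ℝ)
      = hyperfac (2 * c + 2) * ((2 * c + 2)! : ℝ) * ((2 * c + 3)! : ℝ) := by
    rw [← hyperfac_succ', ← hyperfac_succ']
    rfl
  have r4 : (hyperfac (d + c + 2 + 1) : ℝ)
      = hyperfac (d + c + 1) * ((d + c + 1)! : ℝ) * ((d + c + 2)! : ℝ) := by
    rw [← hyperfac_succ', ← hyperfac_succ']
  have r5 : (((d + 1)! : ℕ) : ℝ) = ((d + 1 : ℕ) : ℝ) * (d ! : ℝ) := by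
    rw [Nat.factorial_succ]; push_cast; ring
  have r6 : (((c + 1)! : ℕ) : ℝ) = ((c + 1 : ℕ) : ℝ) * (c ! : ℝ) := by
    rw [Nat.factorial_succ]; push_cast; ring
  have r7 : 2 * (c + 1) = 2 * c + 2 := by ring
  rw [r1, r2, r3, r4, r5, r6, r7, hyperfac_succ' (t2 + n + t4), hyperfac_succ' n,
    hyperfac_succ' (t2 + n), hyperfac_succ' (n + t4), hyperfac_succ' (d + t1 + 1),
    hyperfac_succ' (c + t1 + 1), hyperfac_succ' (d + (t1 + t2) + 1),
    hyperfac_succ' (c + (t1 + t2) + 1)]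
  have c1 : ((c + 1 : ℕ) : ℝ) ≠ 0 := by positivity
  have c2 : ((d + 1 : ℕ) : ℝ) ≠ 0 := by positivity
  generalize ((c + 1 : ℕ) : ℝ) = C at *
  generalize ((d + 1 : ℕ) : ℝ) = D at *
  field_simp [hyperfac_ne, hyperfac2_ne, fac_ne]
  refine div_self ?_
  simp only [ne_eq, _root_.mul_eq_zero, hyperfac_ne, hyperfac2_ne, or_self, not_false_eq_true]
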